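/- arXiv:1108.3054 — 12 statements merged into one kernel-verified Lean document; each statement's English description precedes it below -/
import Mathlib

section
/- Let R be a commutative ring, m an even positive integer (so n = m+1 is odd), and x, y : ℤ/(m+1)ℤ → R. For every i ∈ ℤ/(m+1)ℤ, letting h be the unique element of ℤ/(m+1)ℤ with 2h = i, one has ∑_{j ∈ ℤ/(m+1)ℤ} x_j·y_{i−j} = ∑_{j ∈ ℤ/(m+1)ℤ} x_j·y_j − ∑_{j=1}^{m/2} (x_{h+j} − x_{h−j})·(y_{h+j} − y_{h−j}), where in the last sum the integers j = 1, …, m/2 are reduced modulo m+1. -/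
/-- A sum over `ℤ/(2k+1)ℤ` splits into the term at `0` and the pairs `±j`, `1 ≤ j ≤ k`. -/
theorem ZMod.sum_eq_zero_add_sum_Icc_pm {M : Type*} [AddCommMonoid M] (k : ℕ)
    (f : ZMod (k + k + 1) → M) :
    ∑ t, f t = f 0 + ∑ j ∈ Finset.Icc 1 k, (f (j : ZMod (k + k + 1)) + f (-j)) := by
  have hrange : ∑ t, f t = ∑ j ∈ Finset.range (k + k + 1), f (j : ZMod (k + k + 1)) := by
    rw [Finset.sum_range]
    exact Finset.sum_congr rfl fun t _ => congrArg f (ZMod.natCast_zmod_val t).symm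
  have hIcc : Finset.Icc 1 k = Finset.Ico 1 (k + 1) := by
    ext j
    simp only [Finset.mem_Icc, Finset.mem_Ico]
    omega
  rw [hrange, Finset.sum_range_succ', Nat.cast_zero, add_comm, hIcc, Finset.sum_Ico_eq_sum_range,
    Nat.add_sub_cancel, Finset.sum_range_add, Finset.sum_add_distrib]
  congr 2
  · exact Finset.sum_congr rfl fun j _ => by rw [add_comm j]
  · rw [← Finset.sum_range_reflect]
    refine Finset.sum_congr rfl fun j hj => congrArg f ?_
    have hjk := Finset.mem_range.mp hj
    rw [eq_neg_iff_add_eq_zero, ← Nat.cast_add,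
      show k + (k - 1 - j) + 1 + (1 + j) = k + k + 1 by omega, ZMod.natCast_self]

/-- CVMA identity: for a commutative ring `R`, an even positive integer `m`,
`x, y : ℤ/(m+1)ℤ → R`, every `i`, and `h` the unique element with `2h = i`,
the cyclic convolution at index `i` equals `∑ x_j y_j` minus the sum over
`j = 1, …, m/2` of `(x_{h+j} − x_{h−j})·(y_{h+j} − y_{h−j})`. -/
theorem cvma_identity (R : Type*) [CommRing R] (m : ℕ) (hm : 0 < m) (hme : Even m)
    (x y : ZMod (m + 1) → R) (i h : ZMod (m + 1)) (hh : 2 * h = i) :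
    ∑ j : ZMod (m + 1), x j * y (i - j) =
      (∑ j : ZMod (m + 1), x j * y j) -
        ∑ j ∈ Finset.Icc 1 (m / 2),
          (x (h + (j : ZMod (m + 1))) - x (h - (j : ZMod (m + 1)))) *
            (y (h + (j : ZMod (m + 1))) - y (h - (j : ZMod (m + 1)))) := by
  obtain ⟨k, rfl⟩ := hme
  subst hh
  have hk : (k + k) / 2 = k := by omega
  rw [hk, ← Equiv.sum_comp (Equiv.addLeft h) fun j => x j * y (2 * h - j),
    ← Equiv.sum_comp (Equiv.addLeft h) fun j => x j * y j,
    ZMod.sum_eq_zero_add_sum_Icc_pm, ZMod.sum_eq_zero_add_sum_Icc_pm, add_sub_assoc,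
    ← Finset.sum_sub_distrib]
  have hsub (t : ZMod (k + k + 1)) : 2 * h - (h + t) = h - t := by ring
  simp only [Equiv.coe_addLeft, hsub]
  simp only [← sub_eq_add_neg, sub_neg_eq_add, add_zero, sub_zero]
  congr 1
  exact Finset.sum_congr rfl fun j _ => by ring
end

section
/- Let m be an even positive integer, t an integer, and set Φ = ∑_{i=0}^{m} t^i. Let x, y : ℤ/(m+1)ℤ → ℤ and for each i ∈ ℤ/(m+1)ℤ define z_i = ∑_{j=1}^{m/2} (x_{h−j} − x_{h+j})·(y_{h+j} − y_{h−j}), where h is the unique element of ℤ/(m+1)ℤ with 2h = i and the integers j are reduced modulo m+1. Then ∑_{i=0}^{m} z_i·t^i ≡ (∑_{i=0}^{m} x_i·t^i)·(∑_{i=0}^{m} y_i·t^i) (mod Φ). -/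
open Finset

/-- A sum over `ℤ/nℤ` as a sum over the representatives `0, …, n - 1`. -/
theorem ZMod.sum_univ_eq_sum_range {M : Type*} [AddCommMonoid M] (n : ℕ) [NeZero n]
    (f : ZMod n → M) : ∑ a, f a = ∑ i ∈ range n, f (i : ZMod n) := by
  refine sum_nbij' (fun a => a.val) (fun i => (i : ZMod n)) ?_ ?_ ?_ ?_ ?_
  · exact fun a _ => mem_range.2 a.val_lt
  · exact fun _ _ => mem_univ _
  · exact fun a _ => a.natCast_zmod_val
  · exact fun i hi => ZMod.val_cast_of_lt (mem_range.1 hi)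
  · exact fun a _ => by simp

/-- For odd `n = 2k + 1`, the nonzero residues modulo `n` are `±1, …, ±k`. -/
theorem ZMod.sum_univ_eq_add_sum_Icc_neg {M : Type*} [AddCommMonoid M] (k : ℕ)
    (f : ZMod (k + k + 1) → M) :
    ∑ a, f a = f 0 + ∑ j ∈ Icc 1 k, (f (j : ZMod (k + k + 1)) + f (-(j : ZMod (k + k + 1)))) := by
  have hIcc : ∀ g : ℕ → M, ∑ j ∈ Icc 1 k, g j = ∑ j ∈ range k, g (j + 1) := fun g => by
    rw [range_eq_Ico, sum_Ico_add' g 0 k 1]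
    rfl
  rw [ZMod.sum_univ_eq_sum_range, sum_range_succ', sum_range_add, hIcc, sum_add_distrib, add_comm,
    Nat.cast_zero, ← sum_range_reflect (fun i => f ((k + i + 1 : ℕ) : ZMod (k + k + 1)))]
  congr 2
  refine sum_congr rfl fun j hj => congrArg f ?_
  rw [mem_range] at hj
  rw [eq_neg_iff_add_eq_zero, ← Nat.cast_add,
    show k + (k - 1 - j) + 1 + (j + 1) = k + k + 1 by omega]
  exact ZMod.natCast_self _

/-- The CVMA coefficient at `2h` is the cyclic convolution of `x` and `y` at `2h`, up to a constant
which does not depend on `h`. -/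
theorem sum_cvma_eq_convolution_sub {R : Type*} [CommRing R] (k : ℕ) (x y : ZMod (k + k + 1) → R)
    (h : ZMod (k + k + 1)) :
    ∑ j ∈ Icc 1 k, (x (h - (j : ZMod (k + k + 1))) - x (h + (j : ZMod (k + k + 1)))) *
        (y (h + (j : ZMod (k + k + 1))) - y (h - (j : ZMod (k + k + 1)))) =
      ∑ a, x a * y (2 * h - a) - ∑ a, x a * y a := by
  rw [← sum_sub_distrib, ← Equiv.sum_comp (Equiv.addLeft h), ZMod.sum_univ_eq_add_sum_Icc_neg]
  have hadd : ∀ j, 2 * h - (h + j) = h - j := fun j => by ring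
  simp only [Equiv.coe_addLeft, hadd, sub_neg_eq_add]
  simp only [← sub_eq_add_neg, add_zero, sub_zero, sub_self, zero_add]
  exact sum_congr rfl fun j _ => by ring

/-- Evaluation at an `n`-th root of unity turns cyclic convolution into multiplication. -/
theorem sum_convolution_mul_pow_val {R : Type*} [CommRing R] {n : ℕ} [NeZero n] {u : R}
    (hu : u ^ n = 1) (x y : ZMod n → R) :
    ∑ i : ZMod n, (∑ a, x a * y (i - a)) * u ^ i.val =
      (∑ a, x a * u ^ a.val) * ∑ b, y b * u ^ b.val := by
  have hpow : ∀ a b : ZMod n, u ^ (b + a).val = u ^ a.val * u ^ b.val := fun a b => by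
    rw [ZMod.val_add, ← pow_eq_pow_mod _ hu, pow_add, mul_comm]
  simp_rw [sum_mul]
  rw [sum_comm]
  refine sum_congr rfl fun a _ => ?_
  rw [← Equiv.sum_comp (Equiv.addRight a), mul_sum]
  refine sum_congr rfl fun b _ => ?_
  rw [Equiv.coe_addRight, add_sub_cancel_right, hpow]
  ring

/-- Correctness of the GRP multiplication algorithm (CVMA formulae):
with `Φ = ∑_{i=0}^m t^i` and `z_i = ∑_{j=1}^{m/2} (x_{h−j} − x_{h+j})(y_{h+j} − y_{h−j})`
where `2h = i` in `ℤ/(m+1)ℤ`, one has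
`∑ z_i t^i ≡ (∑ x_i t^i)·(∑ y_i t^i) (mod Φ)`. -/
theorem grp_mul_correct (m : ℕ) (hm : 0 < m) (hme : Even m) (t : ℤ)
    (x y z : ZMod (m + 1) → ℤ) (h : ZMod (m + 1) → ZMod (m + 1))
    (hh : ∀ i, 2 * h i = i)
    (hz : ∀ i, z i = ∑ j ∈ Finset.Icc 1 (m / 2),
        (x (h i - (j : ZMod (m + 1))) - x (h i + (j : ZMod (m + 1)))) *
          (y (h i + (j : ZMod (m + 1))) - y (h i - (j : ZMod (m + 1))))) :
    (∑ i ∈ Finset.range (m + 1), z (i : ZMod (m + 1)) * t ^ i) ≡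
      (∑ i ∈ Finset.range (m + 1), x (i : ZMod (m + 1)) * t ^ i) *
        (∑ i ∈ Finset.range (m + 1), y (i : ZMod (m + 1)) * t ^ i)
      [ZMOD ∑ i ∈ Finset.range (m + 1), t ^ i] := by
  obtain ⟨k, rfl⟩ := hme
  set Φ : ℤ := ∑ i ∈ range (k + k + 1), t ^ i with hΦ
  have hrange : ∀ w : ZMod (k + k + 1) → ℤ,
      ∑ i ∈ range (k + k + 1), w (i : ZMod (k + k + 1)) * t ^ i = ∑ a, w a * t ^ a.val := by
    intro w
    rw [ZMod.sum_univ_eq_sum_range]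
    exact sum_congr rfl fun i hi => by rw [ZMod.val_cast_of_lt (mem_range.1 hi)]
  have hz' : ∀ i, z i = ∑ a, x a * y (i - a) - ∑ a, x a * y a := by
    intro i
    rw [hz, show (k + k) / 2 = k by omega, sum_cvma_eq_convolution_sub, hh]
  let π := Ideal.Quotient.mk (Ideal.span {Φ})
  have hΦπ : π Φ = 0 := Ideal.Quotient.eq_zero_iff_mem.2 (Ideal.mem_span_singleton_self Φ)
  have hu : π t ^ (k + k + 1) = 1 := by
    rw [← sub_eq_zero, ← map_pow, ← map_one π, ← map_sub, ← geom_sum_mul t, ← hΦ, map_mul, hΦπ,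
      zero_mul]
  have hsum : ∑ a : ZMod (k + k + 1), π t ^ a.val = 0 := by
    have h1 := hrange fun _ => 1
    simp only [one_mul] at h1
    simpa only [map_sum, map_pow] using (congrArg π (hΦ.trans h1)).symm.trans hΦπ
  suffices π (∑ a, z a * t ^ a.val) = π ((∑ a, x a * t ^ a.val) * ∑ a, y a * t ^ a.val) by
    rw [hrange, hrange, hrange, Int.modEq_comm, Int.modEq_iff_dvd, ← Ideal.mem_span_singleton]
    exact Ideal.Quotient.eq.1 this
  have hconv := sum_convolution_mul_pow_val hu (fun a => π (x a)) (fun a => π (y a))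
  simp only [hz', map_mul, map_sum, map_pow, map_sub, sub_mul, sum_sub_distrib, ← mul_sum, hsum,
    mul_zero, sub_zero, hconv]
end

section
/- Let m ≥ 1, b ≥ 1, and c be integers, and set t = b·c. Given z : ℤ/(m+1)ℤ → ℤ, define w : ℤ/(m+1)ℤ → ℤ by w_i = ⌊z_i/b⌋ + c·(z_{i+1} mod b), where ⌊·⌋ denotes integer floor division and (· mod b) denotes the residue in {0, …, b−1}. Then b·∑_{i=0}^{m} w_i·t^i ≡ ∑_{i=0}^{m} z_i·t^i (mod t^{m+1} − 1). -/
/-- Correctness of one step of the reduction algorithm `red3`: for `t = b·c` and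
`w_i = ⌊z_i/b⌋ + c·(z_{i+1} mod b)` (indices cyclic mod `m+1`),
`b·∑ w_i t^i ≡ ∑ z_i t^i (mod t^{m+1} − 1)`. -/
theorem red3_step_correct (m : ℕ) (hm : 1 ≤ m) (b c : ℤ) (hb : 1 ≤ b)
    (t : ℤ) (ht : t = b * c) (z w : ZMod (m + 1) → ℤ)
    (hw : ∀ i, w i = z i / b + c * (z (i + 1) % b)) :
    b * ∑ i ∈ Finset.range (m + 1), w (i : ZMod (m + 1)) * t ^ i ≡
      ∑ i ∈ Finset.range (m + 1), z (i : ZMod (m + 1)) * t ^ i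
      [ZMOD t ^ (m + 1) - 1] := by
  have hstep (i : ℕ) : b * (w (i : ZMod (m + 1)) * t ^ i) = z (i : ZMod (m + 1)) * t ^ i +
      (z ((i + 1 : ℕ) : ZMod (m + 1)) % b * t ^ (i + 1) -
        z (i : ZMod (m + 1)) % b * t ^ i) := by
    have hdiv := Int.emod_add_mul_ediv (z (i : ZMod (m + 1))) b
    rw [hw, Nat.cast_succ, pow_succ]
    linear_combination t ^ i * hdiv - z ((i : ZMod (m + 1)) + 1) % b * t ^ i * ht
  rw [Finset.mul_sum, Finset.sum_congr rfl fun i _ => hstep i, Finset.sum_add_distrib,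
    Finset.sum_range_sub fun i : ℕ => z (i : ZMod (m + 1)) % b * t ^ i, ZMod.natCast_self,
    Nat.cast_zero]
  refine (Int.modEq_iff_dvd.mpr ⟨z 0 % b, ?_⟩).symm
  ring
end

section
/- Let m ≥ 1, b ≥ 1, and c be integers, and set t = b·c. Given z : ℤ/(m+1)ℤ → ℤ, for each i the integer z_i + ((−z_i) mod b) is divisible by b, and the vector w defined by w_i = (z_i + ((−z_i) mod b))/b − c·((−z_{i+1}) mod b), where (· mod b) denotes the residue in {0, …, b−1}, satisfies b·∑_{i=0}^{m} w_i·t^i ≡ ∑_{i=0}^{m} z_i·t^i (mod t^{m+1} − 1). -/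
/-- The residue of `-a` modulo `b` completes `a` to a multiple of `b`. -/
theorem dvd_add_neg_emod (a b : ℤ) : b ∣ a + (-a % b) :=
  ⟨-(-a / b), by linarith [Int.emod_add_mul_ediv (-a) b]⟩

/-- Correctness of one step of the reduction algorithm `red2`: for `t = b·c`,
each `z_i + ((−z_i) mod b)` is divisible by `b`, and
`w_i = (z_i + ((−z_i) mod b))/b − c·((−z_{i+1}) mod b)` satisfies
`b·∑ w_i t^i ≡ ∑ z_i t^i (mod t^{m+1} − 1)`. -/
theorem red2_step_correct (m : ℕ) (hm : 1 ≤ m) (b c : ℤ) (hb : 1 ≤ b)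
    (t : ℤ) (ht : t = b * c) (z w : ZMod (m + 1) → ℤ)
    (hw : ∀ i, w i = (z i + (-z i % b)) / b - c * (-z (i + 1) % b)) :
    (∀ i, b ∣ z i + (-z i % b)) ∧
      (b * ∑ i ∈ Finset.range (m + 1), w (i : ZMod (m + 1)) * t ^ i ≡
        ∑ i ∈ Finset.range (m + 1), z (i : ZMod (m + 1)) * t ^ i
        [ZMOD t ^ (m + 1) - 1]) := by
  have hdvd : ∀ i, b ∣ z i + (-z i % b) := fun i => dvd_add_neg_emod (z i) b
  refine ⟨hdvd, ?_⟩
  have hbw : ∀ i, b * w i = z i + (-z i % b) - t * (-z (i + 1) % b) := fun i => by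
    rw [hw, mul_sub, Int.mul_ediv_cancel' (hdvd i), ht, mul_assoc]
  have htele := Finset.sum_range_sub'
    (fun i : ℕ => (-z (i : ZMod (m + 1)) % b) * t ^ i) (m + 1)
  have hdiff : b * ∑ i ∈ Finset.range (m + 1), w (i : ZMod (m + 1)) * t ^ i -
      ∑ i ∈ Finset.range (m + 1), z (i : ZMod (m + 1)) * t ^ i =
      (-z 0 % b) - (-z 0 % b) * t ^ (m + 1) := by
    simp only [ZMod.natCast_self, Nat.cast_zero, pow_zero, mul_one] at htele
    rw [← htele, Finset.mul_sum, ← Finset.sum_sub_distrib]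
    refine Finset.sum_congr rfl fun i _ => ?_
    rw [← mul_assoc, hbw, Nat.cast_succ]
    ring
  exact Int.modEq_iff_dvd.mpr ⟨-z 0 % b, by linarith⟩
end

section
/- Let t ≥ 2 and m ≥ 0 be integers, and let L be the (m+1)×(m+1) integer matrix with L_{i,i} = 1 for 0 ≤ i ≤ m, L_{i,i−1} = −t for 1 ≤ i ≤ m, L_{0,m} = −t, and all other entries 0. Then the ℤ-submodule of ℤ^{m+1} spanned by the columns of L equals the set {u ∈ ℤ^{m+1} : (t^{m+1} − 1) divides ∑_{i=0}^{m} t^{m−i}·u_i}. -/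
/-- Distinct naturals at most `m` have distinct residues modulo `m + 1`. -/
theorem ZMod.natCast_eq_natCast_iff_of_le {m i k : ℕ} (hi : i ≤ m) (hk : k ≤ m) :
    ((i : ZMod (m + 1)) = k) ↔ i = k := by
  rw [ZMod.natCast_eq_natCast_iff', Nat.mod_eq_of_lt (by omega), Nat.mod_eq_of_lt (by omega)]

theorem ZMod.exists_natCast_eq_of_le {m : ℕ} (x : ZMod (m + 1)) :
    ∃ k : ℕ, k ≤ m ∧ (k : ZMod (m + 1)) = x :=
  ⟨x.val, Nat.lt_succ_iff.mp x.val_lt, ZMod.natCast_zmod_val x⟩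

/-- A sequence paired with the delta function at `k ≤ m`. -/
theorem ZMod.sum_range_mul_single {m k : ℕ} (hk : k ≤ m) (f : ℕ → ℤ) :
    ∑ i ∈ Finset.range (m + 1),
      f i * (Pi.single (k : ZMod (m + 1)) 1 : ZMod (m + 1) → ℤ) (i : ZMod (m + 1)) = f k := by
  rw [Finset.sum_eq_single k]
  · simp
  · intro i hi hik
    have him : i ≤ m := Nat.lt_succ_iff.mp (Finset.mem_range.mp hi)
    rw [Pi.single_eq_of_ne (mt (ZMod.natCast_eq_natCast_iff_of_le him hk).mp hik), mul_zero]
  · intro h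
    exact absurd (Finset.mem_range.mpr (by omega)) h

theorem ZMod.eq_sum_range_smul_single {m : ℕ} (u : ZMod (m + 1) → ℤ) :
    u = ∑ i ∈ Finset.range (m + 1),
      u (i : ZMod (m + 1)) • (Pi.single (i : ZMod (m + 1)) 1 : ZMod (m + 1) → ℤ) := by
  ext x
  obtain ⟨k, hk, rfl⟩ := ZMod.exists_natCast_eq_of_le x
  rw [Finset.sum_apply]
  conv_lhs => rw [← ZMod.sum_range_mul_single hk fun i => u (i : ZMod (m + 1))]
  refine Finset.sum_congr rfl fun i _ => ?_
  simp [Pi.single_apply, eq_comm]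

/-- Modulo a submodule containing every `e_j - t e_{j+1}`, the basis vector `e_i` is
`t ^ n e_{i+n}`. -/
theorem ZMod.single_sub_pow_smul_single_mem {m : ℕ} {t : ℤ}
    {N : Submodule ℤ (ZMod (m + 1) → ℤ)}
    (hN : ∀ j, (Pi.single j 1 - t • Pi.single (j + 1) 1 : ZMod (m + 1) → ℤ) ∈ N)
    (i : ZMod (m + 1)) (n : ℕ) :
    (Pi.single i 1 - t ^ n • Pi.single (i + n) 1 : ZMod (m + 1) → ℤ) ∈ N := by
  induction n with
  | zero => simp
  | succ n ih =>
    have h := N.add_mem ih (N.smul_mem (t ^ n) (hN (i + n)))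
    rwa [smul_sub, sub_add_sub_cancel, smul_smul, ← pow_succ, add_assoc, ← Nat.cast_succ] at h

/-- For `t ≥ 2`, the ℤ-submodule of `ℤ^{m+1}` spanned by the columns of the
lattice-basis matrix `L` (diagonal `1`, subdiagonal and top-right corner `−t`,
indices in `ℤ/(m+1)ℤ`) equals the set of vectors `u` with
`(t^{m+1} − 1) ∣ ∑_{i=0}^{m} t^{m−i}·u_i`. -/
theorem lattice_basis_span (t : ℤ) (ht : 2 ≤ t) (m : ℕ)
    (L : Matrix (ZMod (m + 1)) (ZMod (m + 1)) ℤ)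
    (hL : ∀ i j, L i j = (if i = j then 1 else 0) + (if i = j + 1 then -t else 0)) :
    (Submodule.span ℤ (Set.range fun j i => L i j) : Set (ZMod (m + 1) → ℤ)) =
      {u : ZMod (m + 1) → ℤ |
        (t ^ (m + 1) - 1) ∣ ∑ i ∈ Finset.range (m + 1), t ^ (m - i) * u (i : ZMod (m + 1))} := by
  have hcol : ∀ j, (fun i => L i j) =
      (Pi.single j 1 - t • Pi.single (j + 1) 1 : ZMod (m + 1) → ℤ) := by
    intro j
    ext i
    rw [hL]
    simp only [Pi.sub_apply, Pi.smul_apply, Pi.single_apply, smul_eq_mul]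
    split_ifs <;> ring
  ext u
  simp only [SetLike.mem_coe, Set.mem_ofPred_eq]
  constructor
  · intro hu
    induction hu using Submodule.span_induction with
    | mem x hx =>
      obtain ⟨j, hj⟩ := hx
      obtain rfl := (hcol j).symm.trans hj
      obtain ⟨k, hk, rfl⟩ := ZMod.exists_natCast_eq_of_le j
      simp only [Pi.sub_apply, Pi.smul_apply, smul_eq_mul, mul_sub, Finset.sum_sub_distrib,
        mul_left_comm _ t, ← Finset.mul_sum]
      rw [ZMod.sum_range_mul_single hk fun i => t ^ (m - i)]
      rcases hk.lt_or_eq with hlt | rfl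
      · have h := ZMod.sum_range_mul_single (Nat.succ_le_of_lt hlt) fun i => t ^ (m - i)
        rw [Nat.cast_succ] at h
        rw [h, ← pow_succ', show m - k.succ + 1 = m - k by omega, sub_self]
        exact dvd_zero _
      · have h := ZMod.sum_range_mul_single (Nat.zero_le k) fun i => t ^ (k - i)
        have hk0 : (k : ZMod (k + 1)) + 1 = (0 : ℕ) := by
          rw [← Nat.cast_succ, ZMod.natCast_self, Nat.cast_zero]
        rw [hk0, h]
        exact ⟨-1, by rw [Nat.sub_self, Nat.sub_zero]; ring⟩
    | zero => simp
    | add x y _ _ hx hy =>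
      simpa only [Pi.add_apply, mul_add, Finset.sum_add_distrib] using dvd_add hx hy
    | smul a x _ hx =>
      simpa only [Pi.smul_apply, smul_eq_mul, mul_left_comm _ a, ← Finset.mul_sum]
        using hx.mul_left a
  · rintro ⟨c, hc⟩
    set N := Submodule.span ℤ (Set.range fun j i => L i j)
    have hN : ∀ j, (Pi.single j 1 - t • Pi.single (j + 1) 1 : ZMod (m + 1) → ℤ) ∈ N :=
      fun j => hcol j ▸ Submodule.subset_span ⟨j, rfl⟩
    set e : ZMod (m + 1) → ℤ := Pi.single (m : ZMod (m + 1)) 1 with he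
    have hcycle : (t ^ (m + 1) - 1) • e ∈ N := by
      have h := ZMod.single_sub_pow_smul_single_mem hN m (m + 1)
      rw [ZMod.natCast_self, add_zero, ← he] at h
      simpa only [neg_sub, sub_smul, one_smul] using N.neg_mem h
    have hreduce : u - (∑ i ∈ Finset.range (m + 1), t ^ (m - i) * u (i : ZMod (m + 1))) • e
        ∈ N := by
      conv =>
        enter [2, 1]
        rw [ZMod.eq_sum_range_smul_single u]
      rw [Finset.sum_smul, ← Finset.sum_sub_distrib]
      refine N.sum_mem fun i hi => ?_
      have him : i ≤ m := Nat.lt_succ_iff.mp (Finset.mem_range.mp hi)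
      have h := ZMod.single_sub_pow_smul_single_mem hN i (m - i)
      rw [← Nat.cast_add, Nat.add_sub_cancel' him, ← he] at h
      simpa only [smul_sub, smul_smul, mul_comm] using N.smul_mem (u i) h
    rw [hc, mul_comm, mul_smul] at hreduce
    simpa using N.add_mem hreduce (N.smul_mem c hcycle)
end

section
/- Let t, R, m be integers with m ≥ 0 and R ≠ 0, and let L be the (m+1)×(m+1) integer matrix with L_{i,i} = 1 for 0 ≤ i ≤ m, L_{i,i−1} = −t for 1 ≤ i ≤ m, L_{0,m} = −t, and all other entries 0. Suppose z, u ∈ ℤ^{m+1} are such that every component of z + L·u is divisible by R, and set w = (z + L·u)/R (componentwise exact division). Then R·∑_{i=0}^{m} t^{m−i}·w_i ≡ ∑_{i=0}^{m} t^{m−i}·z_i (mod t^{m+1} − 1). -/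
/-- The matrix `1 - t • S`, with `S` the cyclic shift, acts by `u ↦ (u i - t * u (i - 1))ᵢ`. -/
theorem mulVec_one_sub_smul_shift {t : ℤ} {m : ℕ} {L : Matrix (ZMod (m + 1)) (ZMod (m + 1)) ℤ}
    (hL : ∀ i j, L i j = (if i = j then 1 else 0) + (if i = j + 1 then -t else 0))
    (u : ZMod (m + 1) → ℤ) (i : ZMod (m + 1)) :
    L.mulVec u i = u i - t * u (i - 1) := by
  simp only [Matrix.mulVec, dotProduct, hL, add_mul, ite_mul, one_mul, zero_mul,
    Finset.sum_add_distrib, ← sub_eq_iff_eq_add, Finset.sum_ite_eq, Finset.mem_univ, if_true]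
  ring

/-- The residue represented by `(u i - t * u (i - 1))ᵢ` is a multiple of `t ^ (m + 1) - 1`. -/
theorem sum_pow_mul_sub_shift (t : ℤ) (m : ℕ) (u : ZMod (m + 1) → ℤ) :
    ∑ i ∈ Finset.range (m + 1), t ^ (m - i) * (u (i : ZMod (m + 1)) - t * u (i - 1)) =
      (t ^ (m + 1) - 1) * -u m := by
  have hneg : (0 - 1 : ZMod (m + 1)) = m := by
    have h := ZMod.natCast_self (m + 1)
    push_cast at h
    linear_combination -h
  have hshift : ∑ i ∈ Finset.range m,
      t ^ (m - (i + 1)) * (t * u (((i + 1 : ℕ) : ZMod (m + 1)) - 1)) =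
      ∑ i ∈ Finset.range m, t ^ (m - i) * u (i : ZMod (m + 1)) := by
    refine Finset.sum_congr rfl fun i hi => ?_
    have hi' : m - i = m - (i + 1) + 1 := by
      have := Finset.mem_range.mp hi
      omega
    rw [hi', pow_succ, Nat.cast_succ, add_sub_cancel_right, mul_assoc]
  simp only [mul_sub, Finset.sum_sub_distrib]
  rw [Finset.sum_range_succ, Finset.sum_range_succ', hshift, Nat.cast_zero, hneg]
  simp only [Nat.sub_self, Nat.sub_zero]
  ring

/-- Correctness of one step of Montgomery lattice-basis reduction: if every component of
`z + L·u` is divisible by `R ≠ 0` and `w = (z + L·u)/R` componentwise, then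
`R·∑ t^{m−i} w_i ≡ ∑ t^{m−i} z_i (mod t^{m+1} − 1)`. -/
theorem montgomery_lattice_reduction (t R : ℤ) (m : ℕ) (hR : R ≠ 0)
    (L : Matrix (ZMod (m + 1)) (ZMod (m + 1)) ℤ)
    (hL : ∀ i j, L i j = (if i = j then 1 else 0) + (if i = j + 1 then -t else 0))
    (z u w : ZMod (m + 1) → ℤ)
    (hdvd : ∀ i, R ∣ z i + L.mulVec u i)
    (hw : ∀ i, w i = (z i + L.mulVec u i) / R) :
    R * ∑ i ∈ Finset.range (m + 1), t ^ (m - i) * w (i : ZMod (m + 1)) ≡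
      ∑ i ∈ Finset.range (m + 1), t ^ (m - i) * z (i : ZMod (m + 1))
      [ZMOD t ^ (m + 1) - 1] := by
  have hRw : ∀ i, R * w i = z i + (u i - t * u (i - 1)) := fun i => by
    rw [hw, Int.mul_ediv_cancel' (hdvd i), mulVec_one_sub_smul_shift hL]
  refine (Int.modEq_iff_dvd.mpr ⟨-u m, ?_⟩).symm
  rw [← sum_pow_mul_sub_shift, Finset.mul_sum, ← Finset.sum_sub_distrib]
  refine Finset.sum_congr rfl fun i _ => ?_
  linear_combination t ^ (m - i) * hRw i
end

section
/- Let n be an odd prime and l a prime number. If Φ_n(2^l) is prime, where Φ_n denotes the n-th cyclotomic polynomial, then l = n. -/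
/-- For `n ≥ 2`, the integer `Φ_n(2)` is not a unit. -/
theorem not_isUnit_cyclotomic_eval_two {n : ℕ} (hn : 2 ≤ n) :
    ¬ IsUnit ((Polynomial.cyclotomic n ℤ).eval 2) := by
  have h := Polynomial.sub_one_lt_natAbs_cyclotomic_eval (q := 2) hn (by norm_num)
  rw [Int.isUnit_iff_natAbs_eq]
  push_cast at h
  omega

/-- Let `n` be an odd prime and `l` a prime number. If `Φ_n(2^l)` is prime,
where `Φ_n` denotes the `n`-th cyclotomic polynomial, then `l = n`. -/
theorem grp_power_of_two_base (n l : ℕ) (hn : n.Prime) (hodd : Odd n) (hl : l.Prime)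
    (hprime : Prime ((Polynomial.cyclotomic n ℤ).eval (2 ^ l))) : l = n := by
  by_contra hne
  have hdvd : ¬ l ∣ n := fun h => hne ((Nat.prime_dvd_prime_iff_eq hl hn).1 h)
  rw [← Polynomial.expand_eval, Polynomial.cyclotomic_expand_eq_cyclotomic_mul hl hdvd,
    Polynomial.eval_mul] at hprime
  rcases hprime.irreducible.isUnit_or_isUnit rfl with h | h
  · exact not_isUnit_cyclotomic_eval_two
      (hn.two_le.trans (Nat.le_mul_of_pos_right n hl.pos)) h
  · exact not_isUnit_cyclotomic_eval_two hn.two_le h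
end

section
/- Let t ≥ 2 be an even integer and m ≥ 1 an integer. For every integer x with 0 ≤ x < t^{m+1} − 1, there exist integers x_0, x_1, …, x_m with |x_i| ≤ t/2 for all 0 ≤ i ≤ m such that ∑_{i=0}^{m} x_i·t^i ≡ x (mod t^{m+1} − 1). -/
/-- For `h ≥ 1`, every integer `y` with `2 * |y| ≤ (2 * h) ^ (m + 1)` is a sum of `m + 1` signed
base-`2 * h` digits of absolute value at most `h`. -/
theorem exists_signed_digits {h : ℤ} (hh : 1 ≤ h) (m : ℕ) {y : ℤ}
    (hy : 2 * |y| ≤ (2 * h) ^ (m + 1)) :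
    ∃ c : Fin (m + 1) → ℤ, (∀ i, |c i| ≤ h) ∧
      ∑ i : Fin (m + 1), c i * (2 * h) ^ (i : ℕ) = y := by
  induction m generalizing y with
  | zero =>
    refine ⟨fun _ => y, fun _ => ?_, by simp⟩
    simp only [zero_add, pow_one] at hy
    linarith
  | succ m ih =>
    set q := (y + h) / (2 * h)
    set r := (y + h) % (2 * h)
    have hqr : r + 2 * h * q = y + h := Int.emod_add_mul_ediv _ _
    have hr0 : 0 ≤ r := Int.emod_nonneg _ (by lia)
    have hr1 : r < 2 * h := Int.emod_lt_of_pos _ (by lia)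
    have hr : |r - h| ≤ h := abs_le.2 ⟨by linarith, by linarith⟩
    have hq : 2 * |q| ≤ (2 * h) ^ (m + 1) := by
      have hmul : 2 * h * |q| ≤ |y| + h := by
        rw [← abs_of_pos (show 0 < 2 * h by lia), ← abs_mul,
          show 2 * h * q = y - (r - h) by linarith]
        exact (abs_sub _ _).trans (by linarith)
      have hle : 2 * |q| ≤ (2 * h) ^ (m + 1) + 1 := by
        rw [pow_succ] at hy
        refine le_of_mul_le_mul_left (a := 2 * h) ?_ (by lia)
        linarith
      obtain ⟨k, hk⟩ : (2 : ℤ) ∣ (2 * h) ^ (m + 1) :=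
        (dvd_mul_right 2 h).trans (dvd_pow_self _ m.succ_ne_zero)
      lia
    obtain ⟨c, hc, hsum⟩ := ih hq
    refine ⟨Fin.cons (r - h) c, Fin.cases hr hc, ?_⟩
    rw [Fin.sum_univ_succ]
    simp only [Fin.cons_zero, Fin.cons_succ, Fin.val_zero, Fin.val_succ, pow_zero, mul_one,
      pow_succ, ← mul_assoc, ← Finset.sum_mul, hsum]
    linarith

/-- Correctness of base-`t` conversion with least absolute residues: for even `t ≥ 2`
and `m ≥ 1`, every integer `0 ≤ x < t^{m+1} − 1` has a signed base-`t` representation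
`x ≡ ∑_{i=0}^{m} x_i t^i (mod t^{m+1} − 1)` with `|x_i| ≤ t/2` for all `i`. -/
theorem base_t_conversion (t : ℤ) (ht : 2 ≤ t) (hte : Even t) (m : ℕ) (hm : 1 ≤ m)
    (x : ℤ) (hx0 : 0 ≤ x) (hx1 : x < t ^ (m + 1) - 1) :
    ∃ c : Fin (m + 1) → ℤ, (∀ i, |c i| ≤ t / 2) ∧
      (∑ i : Fin (m + 1), c i * t ^ (i : ℕ)) ≡ x [ZMOD t ^ (m + 1) - 1] := by
  obtain ⟨h, rfl⟩ := hte.two_dvd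
  rw [Int.mul_ediv_cancel_left h two_ne_zero]
  have hh : 1 ≤ h := by lia
  rcases le_total (2 * x) ((2 * h) ^ (m + 1)) with hx | hx
  · obtain ⟨c, hc, hsum⟩ := exists_signed_digits hh m (y := x) (by rwa [abs_of_nonneg hx0])
    exact ⟨c, hc, by rw [hsum]⟩
  · obtain ⟨c, hc, hsum⟩ := exists_signed_digits hh m (y := x - ((2 * h) ^ (m + 1) - 1))
      (by rw [abs_of_neg (by linarith)]; linarith)
    exact ⟨c, hc, by rw [hsum]; simp [Int.ModEq]⟩
end

section
/- Let l ≥ 1, k > l, and h ≥ l+1 be integers, let b = 2^l, and let c be an integer with 0 < c < 2^{k−l}. Let m ≥ 1 and z : ℤ/(m+1)ℤ → ℤ with |z_i| ≤ 2^{h−1} for all i, and define w_i = ⌊z_i/b⌋ + c·(z_{i+1} mod b), where ⌊·⌋ denotes integer floor division and (· mod b) denotes the residue in {0, …, b−1}. Then |w_i| < 2^{h−1−l} + 2^k for all i. -/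
/-- One step of the reduction algorithm `red3` shrinks components: with `b = 2^l`,
`0 < c < 2^{k−l}`, inputs `z` with `|z_i| ≤ 2^{h−1}` and
`w_i = ⌊z_i/b⌋ + c·(z_{i+1} mod b)`, one has `|w_i| < 2^{h−1−l} + 2^k`. -/
theorem red3_step_shrinks (l k h : ℕ) (hl : 1 ≤ l) (hk : l < k) (hh : l + 1 ≤ h)
    (b : ℤ) (hb : b = 2 ^ l) (c : ℤ) (hc0 : 0 < c) (hc1 : c < 2 ^ (k - l))
    (m : ℕ) (hm : 1 ≤ m) (z w : ZMod (m + 1) → ℤ)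
    (hz : ∀ i, |z i| ≤ 2 ^ (h - 1))
    (hw : ∀ i, w i = z i / b + c * (z (i + 1) % b)) :
    ∀ i, |w i| < 2 ^ (h - 1 - l) + 2 ^ k := by
  intro i
  have hb0 : 0 < b := hb ▸ by positivity
  have hsplit : (2 : ℤ) ^ (h - 1) = 2 ^ (h - 1 - l) * b := by
    rw [hb, ← pow_add, Nat.sub_add_cancel (by omega)]
  have hk' : (2 : ℤ) ^ k = 2 ^ (k - l) * b := by
    rw [hb, ← pow_add, Nat.sub_add_cancel hk.le]
  obtain ⟨hzl, hzu⟩ := abs_le.mp (hz i)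
  have hql : -2 ^ (h - 1 - l) ≤ z i / b := by
    rw [Int.le_ediv_iff_mul_le hb0]
    linarith
  have hqu : z i / b ≤ 2 ^ (h - 1 - l) :=
    Int.ediv_le_of_le_mul hb0 (hsplit ▸ hzu)
  have hr0 : 0 ≤ z (i + 1) % b := Int.emod_nonneg _ hb0.ne'
  have hrb : z (i + 1) % b < b := Int.emod_lt_of_pos _ hb0
  have hcr0 : 0 ≤ c * (z (i + 1) % b) := mul_nonneg hc0.le hr0
  have hcr : c * (z (i + 1) % b) < 2 ^ k :=
    hk' ▸ mul_lt_mul'' hc1 hrb hc0.le hr0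
  have hk0 : (0 : ℤ) < 2 ^ k := by positivity
  rw [hw, abs_lt]
  constructor <;> linarith
end

section
/- Let m be an even positive integer and let k, l, q be integers with l ≥ 2, k > l, q ≥ 1, and q·(l−1) ≥ ⌈log₂(m/2)⌉ + k + 3. Let b = 2^l, let c be an integer with 0 < c < 2^{k−l}, and let t = c·b. Suppose x, y : ℤ/(m+1)ℤ → ℤ satisfy −2^{k+1} ≤ x_i ≤ 2^{k+1}−1 and −2^{k+1} ≤ y_i ≤ 2^{k+1}−1 for all i. Define z by z_i = ∑_{j=1}^{m/2} (x_{h−j} − x_{h+j})·(y_{h+j} − y_{h−j}) (where 2h = i in ℤ/(m+1)ℤ), and let w be the result of applying q times to z the map v ↦ v' with v'_i = ⌊v_i/b⌋ + c·(v_{i+1} mod b). Then −2^{k+1} ≤ w_i ≤ 2^{k+1}−1 for all i. -/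
/-- One reduction step for the base `b` and the multiplier `c`. -/
def grpRedStep {n : ℕ} (b c : ℤ) (v : ZMod n → ℤ) (i : ZMod n) : ℤ :=
  v i / b + c * (v (i + 1) % b)

/-- Scaled bounds on the components after `r` reduction steps of a vector bounded by `B`. -/
theorem grpRedStep_iterate_bounds {n : ℕ} {b c B : ℤ} (hb : 0 < b) (hc : 0 ≤ c)
    {z : ZMod n → ℤ} (hz : ∀ i, |z i| ≤ B) (r : ℕ) (i : ZMod n) :
    -B - (b ^ r - 1) ≤ b ^ r * (grpRedStep b c)^[r] z i ∧
      b ^ r * (grpRedStep b c)^[r] z i ≤ B + c * b * (b ^ r - 1) := by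
  induction r generalizing i with
  | zero =>
    have := abs_le.mp (hz i)
    simpa using this
  | succ r ih =>
    rw [Function.iterate_succ_apply']
    set v := (grpRedStep b c)^[r] z
    obtain ⟨hlow, hupp⟩ := ih i
    have hpow : 0 < b ^ r := pow_pos hb r
    have hdiv := Int.mul_ediv_add_emod (v i) b
    have hi0 := Int.emod_nonneg (v i) hb.ne'
    have hi1 := Int.emod_lt_of_pos (v i) hb
    have hj0 := Int.emod_nonneg (v (i + 1)) hb.ne'
    have hj1 := Int.emod_lt_of_pos (v (i + 1)) hb
    have hstep_low : v i - (b - 1) ≤ b * grpRedStep b c v i := by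
      have : 0 ≤ b * (c * (v (i + 1) % b)) := by positivity
      unfold grpRedStep
      linarith
    have hstep_upp : b * grpRedStep b c v i ≤ v i + b * (c * (b - 1)) := by
      have : b * (c * (v (i + 1) % b)) ≤ b * (c * (b - 1)) := by
        gcongr
        omega
      unfold grpRedStep
      linarith
    have hmul_low := mul_le_mul_of_nonneg_left hstep_low hpow.le
    have hmul_upp := mul_le_mul_of_nonneg_left hstep_upp hpow.le
    rw [pow_succ]
    constructor <;> linarith

/-- A sum of `N` products of differences of reduced components is at most
`N * 2 ^ (2 * k + 4)` in absolute value. -/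
theorem abs_sum_mul_sub_le {ι : Type*} (x y : ι → ℤ) (k N : ℕ)
    (hx : ∀ i, -2 ^ (k + 1) ≤ x i ∧ x i ≤ 2 ^ (k + 1) - 1)
    (hy : ∀ i, -2 ^ (k + 1) ≤ y i ∧ y i ≤ 2 ^ (k + 1) - 1) (f g : ℕ → ι) :
    |∑ j ∈ Finset.Icc 1 N, (x (f j) - x (g j)) * (y (g j) - y (f j))| ≤
      N * 2 ^ (2 * k + 4) := by
  have hdiff {u : ι → ℤ} (hu : ∀ i, -2 ^ (k + 1) ≤ u i ∧ u i ≤ 2 ^ (k + 1) - 1) (i j : ι) :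
      |u i - u j| ≤ 2 ^ (k + 2) := by
    have hi := hu i
    have hj := hu j
    rw [abs_le, pow_succ 2 (k + 1)]
    constructor <;> linarith
  have hterm : ∀ j ∈ Finset.Icc 1 N,
      |(x (f j) - x (g j)) * (y (g j) - y (f j))| ≤ 2 ^ (2 * k + 4) := by
    intro j _
    calc |(x (f j) - x (g j)) * (y (g j) - y (f j))|
        = |x (f j) - x (g j)| * |y (g j) - y (f j)| := abs_mul _ _
      _ ≤ 2 ^ (k + 2) * 2 ^ (k + 2) := by
        gcongr
        · exact hdiff hx _ _
        · exact hdiff hy _ _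
      _ = 2 ^ (2 * k + 4) := by ring
  calc _ ≤ ∑ j ∈ Finset.Icc 1 N, |(x (f j) - x (g j)) * (y (g j) - y (f j))| :=
        Finset.abs_sum_le_sum_abs _ _
    _ ≤ _ := by simpa using Finset.sum_le_card_nsmul _ _ _ hterm

/-- I/O stability of GRP modular multiplication: if `q·(l−1) ≥ ⌈log₂(m/2)⌉ + k + 3`,
`b = 2^l`, `0 < c < 2^{k−l}`, `t = c·b`, the inputs `x, y` are reduced
(components in `[−2^{k+1}, 2^{k+1}−1]`), `z` is the CVMA product and `w` is the result
of applying `q` reduction steps `v'_i = ⌊v_i/b⌋ + c·(v_{i+1} mod b)` to `z`,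
then `w` is reduced. -/
theorem grp_modmul_io_stable (m : ℕ) (hm : 0 < m) (hme : Even m)
    (k l q : ℕ) (hl : 2 ≤ l) (hkl : l < k) (hq : 1 ≤ q)
    (hstab : Nat.clog 2 (m / 2) + k + 3 ≤ q * (l - 1))
    (b : ℤ) (hb : b = 2 ^ l) (c : ℤ) (hc0 : 0 < c) (hc1 : c < 2 ^ (k - l))
    (t : ℤ) (ht : t = c * b)
    (x y z : ZMod (m + 1) → ℤ) (h : ZMod (m + 1) → ZMod (m + 1))
    (hh : ∀ i, 2 * h i = i)
    (hx : ∀ i, -2 ^ (k + 1) ≤ x i ∧ x i ≤ 2 ^ (k + 1) - 1)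
    (hy : ∀ i, -2 ^ (k + 1) ≤ y i ∧ y i ≤ 2 ^ (k + 1) - 1)
    (hz : ∀ i, z i = ∑ j ∈ Finset.Icc 1 (m / 2),
        (x (h i - (j : ZMod (m + 1))) - x (h i + (j : ZMod (m + 1)))) *
          (y (h i + (j : ZMod (m + 1))) - y (h i - (j : ZMod (m + 1)))))
    (w : ZMod (m + 1) → ℤ)
    (hw : w = (fun (v : ZMod (m + 1) → ℤ) (i : ZMod (m + 1)) =>
        v i / b + c * (v (i + 1) % b))^[q] z) :
    ∀ i, -2 ^ (k + 1) ≤ w i ∧ w i ≤ 2 ^ (k + 1) - 1 := by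
  intro i
  have hbpos : 0 < b := by rw [hb]; positivity
  have hbound : (↑(m / 2) : ℤ) * 2 ^ (2 * k + 4) ≤ 2 ^ k * b ^ q := by
    have hclog : (↑(m / 2) : ℤ) ≤ 2 ^ Nat.clog 2 (m / 2) := by
      exact_mod_cast Nat.le_pow_clog one_lt_two (m / 2)
    have hexp : Nat.clog 2 (m / 2) + (2 * k + 4) ≤ k + l * q := by
      obtain ⟨a, rfl⟩ : ∃ a, l = a + 1 := ⟨l - 1, by omega⟩
      rw [Nat.add_sub_cancel] at hstab
      linarith
    calc (↑(m / 2) : ℤ) * 2 ^ (2 * k + 4)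
        ≤ 2 ^ Nat.clog 2 (m / 2) * 2 ^ (2 * k + 4) := by gcongr
      _ = 2 ^ (Nat.clog 2 (m / 2) + (2 * k + 4)) := (pow_add _ _ _).symm
      _ ≤ 2 ^ (k + l * q) := pow_le_pow_right₀ one_le_two hexp
      _ = 2 ^ k * b ^ q := by rw [hb, pow_add, pow_mul]
  have hzB : ∀ i, |z i| ≤ 2 ^ k * b ^ q := by
    intro i
    rw [hz i]
    exact (abs_sum_mul_sub_le x y k (m / 2) hx hy (fun j => h i - j) (fun j => h i + j)).trans
      hbound
  have hcb : c * b ≤ 2 ^ k := by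
    calc c * b ≤ 2 ^ (k - l) * b := by gcongr
      _ = 2 ^ k := by rw [hb, ← pow_add, Nat.sub_add_cancel hkl.le]
  obtain ⟨hlow, hupp⟩ := grpRedStep_iterate_bounds hbpos hc0.le hzB q i
  have hwi : (grpRedStep b c)^[q] z i = w i := by rw [hw]; rfl
  rw [hwi] at hlow hupp
  have hpow : 0 < b ^ q := pow_pos hbpos q
  have hcbpos : 0 < c * b := mul_pos hc0 hbpos
  have hw_low : -(2 ^ k) - 1 < w i := by
    refine lt_of_mul_lt_mul_left ?_ hpow.le
    linarith
  have hw_upp : w i < 2 ^ k + c * b := by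
    refine lt_of_mul_lt_mul_left ?_ hpow.le
    linarith
  have hk : (0 : ℤ) < 2 ^ k := by positivity
  rw [pow_succ]
  constructor <;> linarith
end

section
/- Let m ≥ 1, let t be an even integer with t ≥ 2, and let b = 2^s for some integer s ≥ 1 (so that t^{m+1}−1 is odd and hence invertible modulo b). Given z_0, …, z_m ∈ ℤ, let u_0 be the unique integer in {0, …, b−1} with (t^{m+1}−1)·u_0 ≡ ∑_{i=0}^{m} z_i·t^i (mod b), and define u_m, u_{m−1}, …, u_1 successively by letting u_i be the unique integer in {0, …, b−1} with u_i ≡ t·u_{(i+1) mod (m+1)} − z_i (mod b). Then: (a) u_0 ≡ t·u_1 − z_0 (mod b); (b) for every 0 ≤ i ≤ m, b divides z_i + u_i − t·u_{(i+1) mod (m+1)}; and (c) the integers w_i = (z_i + u_i − t·u_{(i+1) mod (m+1)})/b satisfy b·∑_{i=0}^{m} w_i·t^i ≡ ∑_{i=0}^{m} z_i·t^i (mod t^{m+1} − 1). -/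
/-- The sum of `(z_i + u_i - t u_{i+1}) t^i` telescopes to `∑ z_i t^i + u_0 - t^n u_n`. -/
lemma sum_add_sub_mul_pow {R A : Type*} [AddMonoidWithOne A] [CommRing R] (t : R)
    (z u : A → R) (n : ℕ) :
    ∑ i ∈ Finset.range n, (z i + u i - t * u (i + 1)) * t ^ i =
      (∑ i ∈ Finset.range n, z i * t ^ i) + u 0 - t ^ n * u n := by
  induction n with
  | zero => simp
  | succ n ih =>
    rw [Finset.sum_range_succ, Finset.sum_range_succ, ih]
    push_cast
    ring

/-- Correctness of the reduction algorithm `red1` for even `t`: with `b = 2^s`,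
digits `u_i ∈ {0,…,b−1}` determined by `(t^{m+1}−1)·u_0 ≡ ∑ z_i t^i (mod b)` and
`u_i ≡ t·u_{i+1} − z_i (mod b)` for `i ≠ 0` (indices cyclic mod `m+1`), one has:
(a) `u_0 ≡ t·u_1 − z_0 (mod b)`; (b) `b ∣ z_i + u_i − t·u_{i+1}` for all `i`;
(c) `w_i = (z_i + u_i − t·u_{i+1})/b` satisfies
`b·∑ w_i t^i ≡ ∑ z_i t^i (mod t^{m+1} − 1)`. -/
theorem red1_correct (m : ℕ) (hm : 1 ≤ m) (t : ℤ) (ht2 : 2 ≤ t) (hte : Even t)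
    (s : ℕ) (hs : 1 ≤ s) (b : ℤ) (hb : b = 2 ^ s)
    (z u : ZMod (m + 1) → ℤ)
    (hu_range : ∀ i, 0 ≤ u i ∧ u i < b)
    (hu0 : (t ^ (m + 1) - 1) * u 0 ≡
      (∑ i ∈ Finset.range (m + 1), z (i : ZMod (m + 1)) * t ^ i) [ZMOD b])
    (hurec : ∀ i : ZMod (m + 1), i ≠ 0 → u i ≡ t * u (i + 1) - z i [ZMOD b])
    (w : ZMod (m + 1) → ℤ)
    (hw : ∀ i, w i = (z i + u i - t * u (i + 1)) / b) :
    (u 0 ≡ t * u 1 - z 0 [ZMOD b]) ∧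
      (∀ i, b ∣ z i + u i - t * u (i + 1)) ∧
      (b * ∑ i ∈ Finset.range (m + 1), w (i : ZMod (m + 1)) * t ^ i ≡
        ∑ i ∈ Finset.range (m + 1), z (i : ZMod (m + 1)) * t ^ i
        [ZMOD t ^ (m + 1) - 1]) := by
  have hsum := sum_add_sub_mul_pow t z u (m + 1)
  rw [show ((m + 1 : ℕ) : ZMod (m + 1)) = 0 from ZMod.natCast_self _] at hsum
  have hne : ∀ i : ZMod (m + 1), i ≠ 0 → b ∣ z i + u i - t * u (i + 1) := fun i hi => by
    have h := (hurec i hi).symm.dvd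
    rwa [show u i - (t * u (i + 1) - z i) = z i + u i - t * u (i + 1) by ring] at h
  have htotal : b ∣ ∑ i ∈ Finset.range (m + 1),
      (z (i : ZMod (m + 1)) + u i - t * u (i + 1)) * t ^ i := by
    rw [hsum]
    have h := hu0.dvd
    convert h using 1
    ring
  have hzero : b ∣ z 0 + u 0 - t * u (0 + 1) := by
    rw [Finset.sum_range_succ', dvd_add_right] at htotal
    · simpa using htotal
    · refine Finset.dvd_sum fun k hk => Dvd.dvd.mul_right (hne _ fun h => ?_) _
      rw [ZMod.natCast_eq_zero_iff] at h
      have := Nat.le_of_dvd k.succ_pos h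
      have := Finset.mem_range.1 hk
      omega
  have hall : ∀ i, b ∣ z i + u i - t * u (i + 1) := fun i => by
    by_cases hi : i = 0
    · exact hi ▸ hzero
    · exact hne i hi
  refine ⟨?_, hall, ?_⟩
  · refine ((Int.modEq_iff_dvd).2 ?_).symm
    rw [zero_add] at hzero
    convert hzero using 1
    ring
  · have hbw : b * ∑ i ∈ Finset.range (m + 1), w (i : ZMod (m + 1)) * t ^ i =
        ∑ i ∈ Finset.range (m + 1), (z (i : ZMod (m + 1)) + u i - t * u (i + 1)) * t ^ i := by
      rw [Finset.mul_sum]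
      refine Finset.sum_congr rfl fun i _ => ?_
      rw [← mul_assoc, hw, Int.mul_ediv_cancel' (hall _)]
    rw [hbw, hsum]
    exact Int.modEq_iff_dvd.2 ⟨u 0, by ring⟩
end

section
/- Let R be a commutative ring, m an even positive integer, and let S = R[X]/(Φ) where Φ = ∑_{i=0}^{m} X^i, with ω denoting the image of X in S. Let x, y : ℤ/(m+1)ℤ → R with x_0 = y_0 = 0, and for each i ∈ ℤ/(m+1)ℤ define q_i = ∑_{j=1}^{m/2} (x_{h+j} − x_{h−j})·(y_{h+j} − y_{h−j}), where h is the unique element of ℤ/(m+1)ℤ with 2h = i and the integers j are reduced modulo m+1. Then in S, (∑_{i=1}^{m} x_i·ω^i)·(∑_{i=1}^{m} y_i·ω^i) = ∑_{i=1}^{m} (q_0 − q_i)·ω^i. -/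
open Polynomial

/-- A sum over `ZMod (m + 1)` as a sum over the representatives `0, …, m`. -/
theorem ZMod.sum_range_natCast {M : Type*} [AddCommMonoid M] (m : ℕ) (g : ZMod (m + 1) → M) :
    ∑ i ∈ Finset.range (m + 1), g (i : ZMod (m + 1)) = ∑ k, g k := by
  refine Finset.sum_bij' (fun i _ => (i : ZMod (m + 1))) (fun k _ => k.val) ?_ ?_ ?_ ?_ ?_
  · simp
  · intro k _
    exact Finset.mem_range.2 (ZMod.val_lt k)
  · intro i hi
    exact ZMod.val_cast_of_lt (Finset.mem_range.1 hi)
  · simp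
  · simp

/-- A polynomial expression in `w` with vanishing constant coefficient, as a sum over
`ZMod (m + 1)`. -/
theorem ZMod.sum_Icc_natCast_mul_pow {S : Type*} [CommRing S] (m : ℕ) (g : ZMod (m + 1) → S)
    (hg : g 0 = 0) (w : S) :
    ∑ i ∈ Finset.Icc 1 m, g (i : ZMod (m + 1)) * w ^ i = ∑ k, g k * w ^ k.val := by
  rw [← ZMod.sum_range_natCast, Finset.sum_range_eq_add_Ico _ (Nat.succ_pos m)]
  simp only [Nat.cast_zero, hg, zero_mul, zero_add]
  refine Finset.sum_congr (by ext; simp) fun i hi => ?_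
  rw [ZMod.val_cast_of_lt (Finset.mem_Ico.1 hi).2]

/-- The elements of `ZMod (2 * n + 1)` are `0` and `±1, …, ±n`. -/
theorem ZMod.sum_eq_add_sum_Icc_add_neg {M : Type*} [AddCommMonoid M] (m n : ℕ)
    (hmn : m = n + n) (g : ZMod (m + 1) → M) :
    ∑ k, g k = g 0 + ∑ j ∈ Finset.Icc 1 n, (g j + g (-j)) := by
  rw [← ZMod.sum_range_natCast, Finset.sum_range_eq_add_Ico _ (Nat.succ_pos m), Nat.cast_zero,
    Finset.sum_add_distrib,
    ← Finset.sum_Ico_consecutive _ (show 1 ≤ n + 1 by omega) (show n + 1 ≤ m + 1 by omega)]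
  congr 2
  refine Finset.sum_bij' (fun i _ => m + 1 - i) (fun j _ => m + 1 - j) ?_ ?_ ?_ ?_ ?_
  · intro i hi
    simp only [Finset.mem_Ico, Finset.mem_Icc] at *
    omega
  · intro i hi
    simp only [Finset.mem_Ico, Finset.mem_Icc] at *
    omega
  · intro i hi
    simp only [Finset.mem_Ico] at *
    omega
  · intro i hi
    simp only [Finset.mem_Icc] at *
    omega
  · intro i hi
    rw [Nat.cast_sub (Finset.mem_Ico.1 hi).2.le, ZMod.natCast_self, zero_sub, neg_neg]

/-- The symmetric products of differences around `h` sum to the inner product of `x` and `y`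
minus the coefficient of their cyclic convolution at `2 * h`. -/
theorem ZMod.sum_sub_mul_sub_eq {R : Type*} [CommRing R] (m n : ℕ) (hmn : m = n + n)
    (x y : ZMod (m + 1) → R) (h : ZMod (m + 1)) :
    ∑ j ∈ Finset.Icc 1 n, (x (h + j) - x (h - j)) * (y (h + j) - y (h - j)) =
      ∑ k, x k * y k - ∑ k, x k * y (2 * h - k) := by
  rw [← Equiv.sum_comp (Equiv.addLeft h) fun k => x k * y k,
    ← Equiv.sum_comp (Equiv.addLeft h) fun k => x k * y (2 * h - k),
    ← Finset.sum_sub_distrib, ZMod.sum_eq_add_sum_Icc_add_neg m n hmn]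
  have hsub (k : ZMod (m + 1)) : 2 * h - (h + k) = h - k := by ring
  simp only [Equiv.coe_addLeft, hsub, add_zero, sub_neg_eq_add]
  simp only [← sub_eq_add_neg, two_mul, add_sub_cancel_right, sub_self, zero_add]
  exact Finset.sum_congr rfl fun j _ => by ring

/-- Powers of an `(m + 1)`-st root of unity multiply cyclically. -/
theorem ZMod.sum_mul_pow_val_mul_sum {S : Type*} [CommRing S] (m : ℕ) (x y : ZMod (m + 1) → S)
    (w : S) (hw : w ^ (m + 1) = 1) :
    (∑ k, x k * w ^ k.val) * ∑ k, y k * w ^ k.val =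
      ∑ i : ZMod (m + 1), (∑ k, x k * y (i - k)) * w ^ i.val := by
  simp_rw [Finset.sum_mul, Finset.mul_sum]
  conv_rhs => rw [Finset.sum_comm]
  refine Finset.sum_congr rfl fun a _ => ?_
  conv_rhs => rw [← Equiv.sum_comp (Equiv.addLeft a)]
  refine Finset.sum_congr rfl fun b _ => ?_
  simp only [Equiv.coe_addLeft]
  rw [add_sub_cancel_left, ZMod.val_add, ← pow_eq_pow_mod _ hw, pow_add]
  ring

/-- CVMA theorem of Nogami, Saito and Morikawa: in `S = R[X]/(Φ)` with
`Φ = X^m + ⋯ + X + 1` and `ω` the image of `X`, for `x, y` with `x_0 = y_0 = 0` and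
`q_i = ∑_{j=1}^{m/2} (x_{h+j} − x_{h−j})(y_{h+j} − y_{h−j})` (where `2h = i` in
`ℤ/(m+1)ℤ`), one has `(∑_{i=1}^m x_i ω^i)·(∑_{i=1}^m y_i ω^i) = ∑_{i=1}^m (q_0 − q_i) ω^i`. -/
theorem cvma_aop_theorem (R : Type*) [CommRing R] (m : ℕ) (hm : 0 < m) (hme : Even m)
    (x y : ZMod (m + 1) → R) (hx0 : x 0 = 0) (hy0 : y 0 = 0)
    (h : ZMod (m + 1) → ZMod (m + 1)) (hh : ∀ i, 2 * h i = i)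
    (q : ZMod (m + 1) → R)
    (hq : ∀ i, q i = ∑ j ∈ Finset.Icc 1 (m / 2),
        (x (h i + (j : ZMod (m + 1))) - x (h i - (j : ZMod (m + 1)))) *
          (y (h i + (j : ZMod (m + 1))) - y (h i - (j : ZMod (m + 1))))) :
    Ideal.Quotient.mk (Ideal.span {(∑ i ∈ Finset.range (m + 1), X ^ i : R[X])})
        ((∑ i ∈ Finset.Icc 1 m, C (x (i : ZMod (m + 1))) * X ^ i) *
          (∑ i ∈ Finset.Icc 1 m, C (y (i : ZMod (m + 1))) * X ^ i)) =
      Ideal.Quotient.mk (Ideal.span {(∑ i ∈ Finset.range (m + 1), X ^ i : R[X])})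
        (∑ i ∈ Finset.Icc 1 m, C (q 0 - q (i : ZMod (m + 1))) * X ^ i) := by
  obtain ⟨n, hn⟩ := hme
  have hn2 : m / 2 = n := by omega
  set φ := Ideal.Quotient.mk (Ideal.span {(∑ i ∈ Finset.range (m + 1), X ^ i : R[X])})
  have hgeom : ∑ i ∈ Finset.range (m + 1), φ X ^ i = 0 := by
    simp_rw [← map_pow, ← map_sum]
    exact Ideal.Quotient.eq_zero_iff_mem.2 (Ideal.mem_span_singleton_self _)
  have hw : φ X ^ (m + 1) = 1 := by
    rw [← sub_eq_zero, ← geom_sum_mul, hgeom, zero_mul]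
  have hsum : ∑ k : ZMod (m + 1), φ X ^ k.val = 0 := by
    rw [← hgeom, ← ZMod.sum_range_natCast]
    exact Finset.sum_congr rfl fun i hi => by rw [ZMod.val_cast_of_lt (Finset.mem_range.1 hi)]
  have hq' (i : ZMod (m + 1)) : q i = ∑ k, x k * y k - ∑ k, x k * y (i - k) := by
    rw [hq, hn2, ZMod.sum_sub_mul_sub_eq m n hn, hh]
  simp only [map_mul, map_sum, map_pow]
  rw [ZMod.sum_Icc_natCast_mul_pow m (fun k => φ (C (x k))) (by simp [hx0]),
    ZMod.sum_Icc_natCast_mul_pow m (fun k => φ (C (y k))) (by simp [hy0]),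
    ZMod.sum_Icc_natCast_mul_pow m (fun k => φ (C (q 0 - q k))) (by simp),
    ZMod.sum_mul_pow_val_mul_sum m _ _ _ hw]
  simp only [hq', sub_sub_sub_cancel_left, map_sub, map_sum, map_mul, sub_mul,
    Finset.sum_sub_distrib]
  rw [← Finset.mul_sum, hsum, mul_zero, sub_zero]
end
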